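/- For all n ≥ 1, the following polynomial identity holds in ℤ[q,t]: the sum over all 321-avoiding permutations π of {1,…,n} of q^{2·lis(π)+1} t^{2·ldes(π)} equals the sum over all π ∈ T*_{2n+1} of sign(π)·q^{lis(π)} t^{ldes(π)}, where T*_{2n+1} is the set of 321-avoiding permutations of {1,…,2n+1} whose last descent is even and whose longest increasing subsequence has odd length. -/

import Mathlib

open scoped Classical
open MvPolynomial

/-- A permutation of `{1,…,n}` (modeled on `Fin n`) is 321-avoiding if there are no
indices `i < j < k` with `π i > π j > π k`. -/
def Avoids321 {n : ℕ} (π : Equiv.Perm (Fin n)) : Prop :=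
  ¬ ∃ i j k : Fin n, i < j ∧ j < k ∧ π k < π j ∧ π j < π i

/-- The length of the longest increasing subsequence of a permutation. -/
noncomputable def lis {n : ℕ} (π : Equiv.Perm (Fin n)) : ℕ :=
  sSup {k : ℕ | ∃ s : Finset (Fin n),
    (∀ i ∈ s, ∀ j ∈ s, i < j → π i < π j) ∧ s.card = k}

/-- The last (largest) descent of a permutation, in 1-based positions:
the largest `d` with `π(d) > π(d+1)`, and `0` for the identity (no descent). -/
noncomputable def ldes {n : ℕ} (π : Equiv.Perm (Fin n)) : ℕ :=
  sSup {d : ℕ | 1 ≤ d ∧ ∃ h : d < n, π ⟨d, h⟩ < π ⟨d - 1, by omega⟩}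

/-- A word over `Bool` is read from its last letter to its first; `true` is an up step and
`false` a down step. `Ballot w` says that no initial segment (in this reading) has more down
steps than up steps. -/
def Ballot : List Bool → Prop
  | [] => True
  | true :: w => Ballot w
  | false :: w => Ballot w ∧ w.count false < w.count true

/-- The number of leading `false` letters. -/
def leadFalse : List Bool → ℕ
  | false :: w => leadFalse w + 1
  | _ => 0

/-- The length of the longest prefix of the form `true ⋯ true false ⋯ false`. -/
def tailRun : List Bool → ℕ
  | [] => 0
  | true :: w => tailRun w + 1
  | false :: w => leadFalse w + 1

/-- Insert an up step after the first `m` letters and turn the last up step among these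
`m` letters, if there is one, into a down step. -/
def bump : ℕ → List Bool → List Bool
  | 0, w => true :: w
  | _ + 1, [] => [true]
  | m + 1, c :: w => (c && decide (true ∈ w.take m)) :: bump m w

/-- Remove the first `true`. -/
def removeUp : List Bool → List Bool
  | [] => []
  | true :: w => w
  | false :: w => false :: removeUp w

/-- Turn the first `false` into `true` and remove the `true` that follows it. -/
def unbump : List Bool → List Bool
  | [] => []
  | true :: w => true :: unbump w
  | false :: w => true :: removeUp w

/-- Some `false` is followed by a later `true`. -/
def HasPeak : List Bool → Prop
  | [] => False
  | true :: w => HasPeak w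
  | false :: w => true ∈ w

theorem leadFalse_le_tailRun (w : List Bool) : leadFalse w ≤ tailRun w := by
  cases w with
  | nil => simp [leadFalse]
  | cons c w => cases c <;> simp [leadFalse, tailRun]

theorem leadFalse_le_length (w : List Bool) : leadFalse w ≤ w.length := by
  induction w with
  | nil => simp [leadFalse]
  | cons c w ih => cases c <;> simp [leadFalse, ih]

theorem tailRun_le_length (w : List Bool) : tailRun w ≤ w.length := by
  induction w with
  | nil => simp [tailRun]
  | cons c w ih => cases c <;> simp [tailRun, ih, leadFalse_le_length]

theorem true_notMem_take {w : List Bool} {m : ℕ} (h : m ≤ leadFalse w) : true ∉ w.take m := by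
  induction w generalizing m with
  | nil => simp
  | cons c w ih =>
    cases m with
    | zero => simp
    | succ m =>
      cases c
      · simpa using ih (by simpa [leadFalse] using h)
      · simp [leadFalse] at h

theorem length_bump (m : ℕ) (w : List Bool) : (bump m w).length = w.length + 1 := by
  induction w generalizing m with
  | nil => cases m <;> simp [bump]
  | cons c w ih => cases m <;> simp [bump, ih]

theorem true_mem_bump (m : ℕ) (w : List Bool) : true ∈ bump m w := by
  induction w generalizing m with
  | nil => cases m <;> simp [bump]
  | cons c w ih => cases m <;> simp [bump, ih]

theorem removeUp_bump {m : ℕ} {w : List Bool} (h : true ∉ w.take m) (hm : m ≤ w.length) :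
    removeUp (bump m w) = w := by
  induction w generalizing m with
  | nil => simp at hm; subst hm; simp [bump, removeUp]
  | cons c w ih =>
    cases m with
    | zero => simp [bump, removeUp]
    | succ m =>
      cases c
      · simp at h hm
        simp [bump, removeUp, ih h hm]
      · simp at h

theorem leadFalse_bump {m : ℕ} {w : List Bool} (h : true ∉ w.take m) (hm : m ≤ w.length) :
    leadFalse (bump m w) = m := by
  induction w generalizing m with
  | nil => simp at hm; subst hm; simp [bump, leadFalse]
  | cons c w ih =>
    cases m with
    | zero => simp [bump, leadFalse]
    | succ m =>
      cases c
      · simp at h hm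
        simp [bump, leadFalse, ih h hm]
      · simp at h

theorem unbump_bump {m : ℕ} {w : List Bool} (h : true ∈ w.take m) (hm : m ≤ tailRun w) :
    unbump (bump m w) = w := by
  induction w generalizing m with
  | nil => simp at h
  | cons c w ih =>
    cases m with
    | zero => simp at h
    | succ m =>
      cases c
      · simp only [tailRun, Nat.add_le_add_iff_right] at hm
        exact absurd (by simpa using h) (true_notMem_take hm)
      · simp only [tailRun, Nat.add_le_add_iff_right] at hm
        by_cases h' : true ∈ w.take m
        · simp [bump, h', unbump, ih h' hm]
        · simp [bump, h', unbump, removeUp_bump h' (hm.trans (tailRun_le_length w))]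

theorem tailRun_bump {m : ℕ} {w : List Bool} (h : 0 < m) (hm : m ≤ tailRun w) :
    tailRun (bump m w) = m := by
  induction w generalizing m with
  | nil => simp [tailRun] at hm; omega
  | cons c w ih =>
    cases m with
    | zero => simp at h
    | succ m =>
      cases c
      · simp only [tailRun, Nat.add_le_add_iff_right] at hm
        simp [bump, tailRun,
          leadFalse_bump (true_notMem_take hm) (hm.trans (leadFalse_le_length w))]
      · simp only [tailRun, Nat.add_le_add_iff_right] at hm
        by_cases h' : true ∈ w.take m
        · have : 0 < m := by
            rcases m with _ | m
            · simp at h'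
            · simp
          simp [bump, h', tailRun, ih this hm]
        · simp [bump, h', tailRun, leadFalse_bump h' (hm.trans (tailRun_le_length w))]

theorem hasPeak_bump {m : ℕ} {w : List Bool} (h : 0 < m) (hm : m ≤ tailRun w) :
    HasPeak (bump m w) := by
  induction w generalizing m with
  | nil => simp [tailRun] at hm; omega
  | cons c w ih =>
    cases m with
    | zero => simp at h
    | succ m =>
      cases c
      · simp [bump, HasPeak, true_mem_bump]
      · simp only [tailRun, Nat.add_le_add_iff_right] at hm
        by_cases h' : true ∈ w.take m
        · have : 0 < m := by
            rcases m with _ | m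
            · simp at h'
            · simp
          simp [bump, h', HasPeak, ih this hm]
        · simp [bump, h', HasPeak, true_mem_bump]

theorem bump_removeUp {u : List Bool} (h : true ∈ u) :
    bump (leadFalse u) (removeUp u) = u ∧ leadFalse u ≤ leadFalse (removeUp u) := by
  induction u with
  | nil => simp at h
  | cons c w ih =>
    cases c
    · simpa [leadFalse, removeUp, bump] using ih (by simpa using h)
    · simp [leadFalse, removeUp, bump]

theorem HasPeak.exists_unbump {w : List Bool} (h : HasPeak w) :
    0 < tailRun w ∧ ∃ v, unbump w = true :: v := by
  cases w with
  | nil => simp [HasPeak] at h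
  | cons c w => cases c <;> simp [tailRun, unbump]

theorem bump_unbump {w : List Bool} (h : HasPeak w) :
    bump (tailRun w) (unbump w) = w ∧ tailRun w ≤ tailRun (unbump w) := by
  induction w with
  | nil => simp [HasPeak] at h
  | cons c w ih =>
    cases c
    · obtain ⟨h1, h2⟩ := bump_removeUp h
      simp [tailRun, unbump, bump, h1, true_notMem_take h2, h2.trans (leadFalse_le_tailRun _)]
    · obtain ⟨h1, h2⟩ := ih h
      obtain ⟨h3, v, hv⟩ := HasPeak.exists_unbump (w := w) h
      simp only [tailRun, unbump, bump, h1, Bool.true_and, List.cons.injEq, and_true,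
        Nat.add_le_add_iff_right, h2, decide_eq_true_eq]
      obtain ⟨t, ht⟩ := Nat.exists_eq_succ_of_ne_zero h3.ne'
      simp [hv, ht]

theorem count_true_removeUp {u : List Bool} (h : true ∈ u) :
    (removeUp u).count true + 1 = u.count true := by
  induction u with
  | nil => simp at h
  | cons c w ih =>
    cases c
    · simpa [removeUp] using ih (by simpa using h)
    · simp [removeUp]

theorem count_false_removeUp (u : List Bool) : (removeUp u).count false = u.count false := by
  induction u with
  | nil => simp [removeUp]
  | cons c w ih => cases c <;> simp [removeUp, ih]

theorem count_true_unbump {w : List Bool} (h : HasPeak w) :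
    (unbump w).count true = w.count true := by
  induction w with
  | nil => simp [HasPeak] at h
  | cons c w ih =>
    cases c
    · simpa [unbump] using count_true_removeUp h
    · simpa [unbump] using ih h

theorem count_false_unbump {w : List Bool} (h : HasPeak w) :
    (unbump w).count false + 1 = w.count false := by
  induction w with
  | nil => simp [HasPeak] at h
  | cons c w ih =>
    cases c
    · simpa [unbump] using count_false_removeUp w
    · simpa [unbump] using ih h

theorem Ballot.count_le {w : List Bool} (h : Ballot w) : w.count false ≤ w.count true := by
  induction w with
  | nil => simp
  | cons c w ih =>
    cases c
    · have := h.2; simp; omega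
    · have := ih h; simp; omega

theorem ballot_removeUp {u : List Bool} (h : true ∈ u) :
    Ballot (removeUp u) ↔ Ballot (false :: u) := by
  induction u with
  | nil => simp at h
  | cons c w ih =>
    cases c
    · have h' : true ∈ w := by simpa using h
      have h1 := count_true_removeUp h'
      have h2 := count_false_removeUp w
      have h3 := ih h'
      simp only [removeUp, Ballot] at h3 ⊢
      rw [h3]
      simp
      intros
      omega
    · simp only [removeUp, Ballot]
      refine ⟨fun h => ⟨h, ?_⟩, fun h => h.1⟩
      have := h.count_le
      simp; omega

theorem ballot_unbump {w : List Bool} (h : HasPeak w) : Ballot (unbump w) ↔ Ballot w := by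
  induction w with
  | nil => simp [HasPeak] at h
  | cons c w ih =>
    cases c
    · exact ballot_removeUp h
    · exact ih h

theorem ballot_removeUp_cons {u : List Bool} (h : true ∈ u) :
    Ballot (removeUp (false :: u)) ↔
      Ballot (false :: u) ∧ u.count false + 1 < u.count true := by
  have h1 := count_true_removeUp h
  have h2 := count_false_removeUp u
  change Ballot (removeUp u) ∧ _ ↔ _
  rw [ballot_removeUp h]
  refine and_congr_right fun _ => ?_
  omega

theorem Ballot.bump {m : ℕ} {w : List Bool} (h : Ballot w) (hm : m ≤ tailRun w) :
    Ballot (bump m w) := by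
  rcases Nat.eq_zero_or_pos m with rfl | h0
  · cases w <;> exact h
  by_cases h' : true ∈ w.take m
  · rw [← ballot_unbump (hasPeak_bump h0 hm), unbump_bump h' hm]
    exact h
  · cases w with
    | nil => simp [tailRun] at hm; omega
    | cons c w =>
      obtain ⟨m, rfl⟩ := Nat.exists_eq_succ_of_ne_zero h0.ne'
      cases c
      · have h2 := removeUp_bump h' (hm.trans (tailRun_le_length _))
        simp only [_root_.bump, Bool.false_and] at h2 ⊢
        rw [← h2] at h
        exact ((ballot_removeUp_cons (true_mem_bump _ _)).1 h).1
      · simp at h'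

/-- The sign of a word: `e` to the number of pairs formed by a `true` and a later `false`. -/
def wordSign {R : Type*} [CommRing R] (e : R) : List Bool → R
  | [] => 1
  | true :: w => e ^ w.count false * wordSign e w
  | false :: w => wordSign e w

section Sign

variable {R : Type*} [CommRing R] {e : R}

theorem wordSign_removeUp (he : e * e = 1) {u : List Bool} (h : true ∈ u) :
    wordSign e u = e ^ (u.count false + leadFalse u) * wordSign e (removeUp u) := by
  induction u with
  | nil => simp at h
  | cons c w ih =>
    cases c
    · have := ih (by simpa using h)
      simp only [wordSign, removeUp, leadFalse, List.count_cons_self]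
      rw [this]
      linear_combination (-(e ^ (w.count false + leadFalse w) * wordSign e (removeUp w))) * he
    · simp [wordSign, removeUp, leadFalse]

theorem wordSign_unbump (he : e * e = 1) {w : List Bool} (h : HasPeak w) :
    wordSign e w = e ^ (tailRun w + 1) * wordSign e (unbump w) := by
  induction w with
  | nil => simp [HasPeak] at h
  | cons c w ih =>
    cases c
    · simp only [wordSign, unbump, tailRun, count_false_removeUp]
      rw [wordSign_removeUp he h]
      linear_combination (-(e ^ (w.count false + leadFalse w) * wordSign e (removeUp w))) * he
    · have := ih h
      have h2 := count_false_unbump (w := w) h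
      simp only [wordSign, unbump, tailRun]
      rw [this, ← h2]
      ring

end Sign

theorem bump_eq_iff {m : ℕ} (hm : 0 < m) (w w' : List Bool) :
    (m ≤ tailRun w ∧ bump m w = w') ↔
      m = tailRun w' ∧ ((HasPeak w' ∧ w = unbump w') ∨
        ∃ u, w' = false :: u ∧ true ∈ u ∧ w = removeUp w') := by
  constructor
  · rintro ⟨h, rfl⟩
    refine ⟨(tailRun_bump hm h).symm, ?_⟩
    by_cases h' : true ∈ w.take m
    · exact Or.inl ⟨hasPeak_bump hm h, (unbump_bump h' h).symm⟩
    · refine Or.inr ?_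
      rw [removeUp_bump h' (h.trans (tailRun_le_length w))]
      cases w with
      | nil => simp [tailRun] at h; omega
      | cons c w =>
        obtain ⟨m, rfl⟩ := Nat.exists_eq_succ_of_ne_zero hm.ne'
        cases c
        · exact ⟨bump m w, by simp [bump], true_mem_bump _ _, rfl⟩
        · simp at h'
  · rintro ⟨rfl, ⟨h, rfl⟩ | ⟨u, rfl, h, rfl⟩⟩
    · exact (bump_unbump h).symm
    · obtain ⟨h1, h2⟩ := bump_removeUp h
      simpa [tailRun, removeUp, bump, h1] using h2

theorem count_drop_bump {m : ℕ} {w : List Bool} (hm : m ≤ w.length) {j : ℕ} (hj : j ≤ m) :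
    ((bump m w).drop j).count true = max ((w.drop j).count true) ((w.drop m).count true + 1) := by
  induction w generalizing m j with
  | nil =>
    simp at hm
    subst hm
    simp at hj
    subst hj
    simp [bump]
  | cons c w ih =>
    cases m with
    | zero =>
      simp at hj
      subst hj
      cases c <;> simp [bump]
    | succ m =>
      simp only [List.length_cons, Nat.add_le_add_iff_right] at hm
      cases j with
      | succ j => simpa [bump] using ih hm (by omega : j ≤ m)
      | zero =>
        have h1 := ih hm (Nat.zero_le m)
        have h2 : w.count true = (w.take m).count true + (w.drop m).count true := by
          rw [← List.count_append, List.take_append_drop]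
        simp only [List.drop_zero] at h1
        cases c
        · simpa [bump] using h1
        · by_cases h' : true ∈ w.take m
          · have := List.count_pos_iff.2 h'
            simp [bump, h', h1]
            omega
          · have := List.count_eq_zero.2 h'
            simp [bump, h', h1]
            omega

theorem drop_bump_succ {m : ℕ} {w : List Bool} (hm : m ≤ w.length) {j : ℕ} (hj : m ≤ j) :
    (bump m w).drop (j + 1) = w.drop j := by
  induction w generalizing m j with
  | nil => simp at hm; subst hm; simp [bump]
  | cons c w ih =>
    cases m with
    | zero => simp [bump]
    | succ m =>
      obtain ⟨j, rfl⟩ : ∃ i, j = i + 1 := ⟨j - 1, by omega⟩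
      simpa [bump] using ih (by simpa using hm) (by omega : m ≤ j)

/-- The permutation obtained from `σ` by inserting a new maximum in position `k`. -/
def insertMax {n : ℕ} (k : Fin (n + 1)) (σ : Equiv.Perm (Fin n)) : Equiv.Perm (Fin (n + 1)) :=
  (finSuccEquiv' k).trans ((Equiv.optionCongr σ).trans (finSuccEquiv' (Fin.last n)).symm)

section InsertMax

variable {n : ℕ}

@[simp]
theorem insertMax_self (k : Fin (n + 1)) (σ : Equiv.Perm (Fin n)) :
    insertMax k σ k = Fin.last n := by
  simp [insertMax]

@[simp]
theorem insertMax_succAbove (k : Fin (n + 1)) (σ : Equiv.Perm (Fin n)) (i : Fin n) :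
    insertMax k σ (k.succAbove i) = (σ i).castSucc := by
  simp [insertMax]

theorem sign_insertMax (k : Fin (n + 1)) (σ : Equiv.Perm (Fin n)) :
    Equiv.Perm.sign (insertMax k σ) = (-1) ^ (n - k : ℕ) * Equiv.Perm.sign σ := by
  have h : insertMax k σ * Fin.cycleIcc k (Fin.last n) = insertMax (Fin.last n) σ := by
    ext i
    refine Fin.lastCases ?_ (fun i => ?_) i
    · rw [Equiv.Perm.mul_apply, Fin.cycleIcc_of_last (Fin.le_last k), insertMax_self,
        insertMax_self]
    · have h1 := congrFun (Fin.cycleIcc_comp_succAbove k (Fin.last n) (Fin.le_last k)) i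
      have h2 := insertMax_succAbove (Fin.last n) σ i
      simp only [Function.comp_apply, Fin.succAbove_last] at h1 h2
      rw [Equiv.Perm.mul_apply, h1, insertMax_succAbove, h2]
  have h2 : Equiv.Perm.sign (insertMax (Fin.last n) σ) = Equiv.Perm.sign σ := by
    have := Equiv.Perm.sign_symm_trans_trans (Equiv.optionCongr σ) (finSuccEquiv' (Fin.last n)).symm
    rw [Equiv.optionCongr_sign] at this
    exact this
  rw [← h2, ← h, Equiv.Perm.sign_mul, Fin.sign_cycleIcc_of_le (Fin.le_last k), Fin.val_last,
    mul_left_comm, ← mul_pow]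
  simp

theorem insertMax_bijective :
    Function.Bijective fun p : Fin (n + 1) × Equiv.Perm (Fin n) => insertMax p.1 p.2 := by
  rw [Fintype.bijective_iff_injective_and_card]
  refine ⟨?_, by simp [Fintype.card_perm, Nat.factorial_succ]⟩
  rintro ⟨k, σ⟩ ⟨l, τ⟩ h
  simp only at h
  obtain rfl : k = l := by
    apply (insertMax k σ).injective
    rw [insertMax_self, h, insertMax_self]
  have : σ = τ := by
    ext i
    have := congrArg (fun π => (π (k.succAbove i)).val) h
    simpa using this
  rw [this]

/-- Permutations of `Fin (n + 1)` as the position of the maximum together with the permutation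
left after removing it. -/
noncomputable def insertMaxEquiv (n : ℕ) :
    Fin (n + 1) × Equiv.Perm (Fin n) ≃ Equiv.Perm (Fin (n + 1)) :=
  Equiv.ofBijective _ insertMax_bijective

theorem exists_insertMax (π : Equiv.Perm (Fin (n + 1))) : ∃ k σ, insertMax k σ = π := by
  obtain ⟨p, hp⟩ := insertMax_bijective.2 π
  exact ⟨p.1, p.2, hp⟩

end InsertMax

/-- The word of a permutation: its letter at position `i` (from the end) tells whether the
longest increasing subsequence of a prefix grows when the prefix is extended by one entry. -/
noncomputable def lisWord : ∀ {n : ℕ}, Equiv.Perm (Fin n) → List Bool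
  | 0, _ => []
  | n + 1, π => bump (n - ((insertMaxEquiv n).symm π).1) (lisWord ((insertMaxEquiv n).symm π).2)

section Word

variable {n : ℕ}

theorem lisWord_insertMax (k : Fin (n + 1)) (σ : Equiv.Perm (Fin n)) :
    lisWord (insertMax k σ) = bump (n - k) (lisWord σ) := by
  have : (insertMaxEquiv n).symm (insertMax k σ) = (k, σ) :=
    (insertMaxEquiv n).symm_apply_apply (k, σ)
  rw [lisWord, this]

theorem length_lisWord (π : Equiv.Perm (Fin n)) : (lisWord π).length = n := by
  induction n with
  | zero => simp [lisWord]
  | succ n ih =>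
    obtain ⟨k, σ, rfl⟩ := exists_insertMax π
    rw [lisWord_insertMax, length_bump, ih]

/-- The set `s` of positions carries an increasing subsequence of `π`. -/
def IsIncr (π : Equiv.Perm (Fin n)) (s : Finset (Fin n)) : Prop :=
  ∀ i ∈ s, ∀ j ∈ s, i < j → π i < π j

theorem isIncr_map {k : Fin (n + 1)} {σ : Equiv.Perm (Fin n)} {s : Finset (Fin n)} :
    IsIncr (insertMax k σ) (s.map k.succAboveEmb) ↔ IsIncr σ s := by
  simp [IsIncr]

theorem isIncr_insert_map {k : Fin (n + 1)} {σ : Equiv.Perm (Fin n)} {s : Finset (Fin n)} :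
    IsIncr (insertMax k σ) (insert k (s.map k.succAboveEmb)) ↔
      IsIncr σ s ∧ ∀ x ∈ s, (x : ℕ) < k := by
  constructor
  · intro h
    refine ⟨isIncr_map.1 fun i hi j hj => h i (Finset.mem_insert_of_mem hi) j
      (Finset.mem_insert_of_mem hj), fun x hx => ?_⟩
    by_contra hlt
    have h1 : k < k.succAbove x := Fin.lt_succAbove_iff_le_castSucc k x |>.2 (by
      rw [Fin.le_def]; simpa using hlt)
    have h2 := h k (by simp) (k.succAbove x) (by simp [hx]) h1
    rw [insertMax_self] at h2
    exact absurd h2 (Fin.le_last _).not_gt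
  · rintro ⟨h, hk⟩ i hi j hj hij
    simp only [Finset.mem_insert, Finset.mem_map, Fin.succAboveEmb_apply] at hi hj
    rcases hi with rfl | ⟨i, hi, rfl⟩ <;> rcases hj with rfl | ⟨j, hj, rfl⟩
    · exact absurd hij (lt_irrefl _)
    · have := Fin.lt_succAbove_iff_le_castSucc i j |>.1 hij
      rw [Fin.le_def] at this
      exact absurd (hk j hj) (by simpa using this)
    · simp
    · simp only [insertMax_succAbove, Fin.castSucc_lt_castSucc_iff]
      exact h i hi j hj (by simpa using hij)

theorem exists_eq_map_or_insert (k : Fin (n + 1)) (s : Finset (Fin (n + 1))) :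
    ∃ t : Finset (Fin n), s = t.map k.succAboveEmb ∨ s = insert k (t.map k.succAboveEmb) := by
  refine ⟨Finset.univ.filter fun x => k.succAbove x ∈ s, ?_⟩
  by_cases hk : k ∈ s
  · right
    ext x
    refine Fin.succAboveCases k ?_ (fun x => ?_) x
    · simp [hk]
    · simp [Fin.succAbove_ne]
  · left
    ext x
    refine Fin.succAboveCases k ?_ (fun x => ?_) x
    · simp [hk, Fin.succAbove_ne]
    · simp

theorem succAbove_lt_iff (k : Fin (n + 1)) (x : Fin n) (i : ℕ) :
    (k.succAbove x : ℕ) < i ↔ if i ≤ k then (x : ℕ) < i else (x : ℕ) < i - 1 := by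
  rcases lt_or_ge x.castSucc k with h | h
  · rw [Fin.succAbove_of_castSucc_lt _ _ h]
    rw [Fin.lt_def] at h
    simp only [Fin.val_castSucc] at h ⊢
    split_ifs <;> omega
  · rw [Fin.succAbove_of_le_castSucc _ _ h]
    rw [Fin.le_def] at h
    simp only [Fin.val_castSucc, Fin.val_succ] at h ⊢
    split_ifs <;> omega

theorem isGreatest_count_drop (π : Equiv.Perm (Fin n)) {i : ℕ} (hi : i ≤ n) :
    IsGreatest {c | ∃ s : Finset (Fin n), IsIncr π s ∧ (∀ x ∈ s, (x : ℕ) < i) ∧ s.card = c}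
      (((lisWord π).drop (n - i)).count true) := by
  induction n generalizing i with
  | zero =>
    refine ⟨⟨∅, by simp [IsIncr, lisWord]⟩, ?_⟩
    rintro c ⟨s, -, -, rfl⟩
    simp [Finset.eq_empty_of_isEmpty s]
  | succ n ih =>
    obtain ⟨k, σ, rfl⟩ := exists_insertMax π
    have hlen := length_lisWord σ
    have hkn : (k : ℕ) ≤ n := Nat.lt_succ_iff.1 k.2
    rw [lisWord_insertMax]
    by_cases hik : i ≤ k
    · have h1 : n + 1 - i = (n - i) + 1 := by omega
      rw [h1, drop_bump_succ (by omega) (by omega)]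
      obtain ⟨⟨s, hs, hsi, hc⟩, hmax⟩ := ih σ (i := i) (by omega)
      refine ⟨⟨s.map k.succAboveEmb, isIncr_map.2 hs, ?_, by simpa using hc⟩, ?_⟩
      · simpa [succAbove_lt_iff, hik] using hsi
      · rintro c ⟨s, hs, hsi, rfl⟩
        obtain ⟨t, rfl | rfl⟩ := exists_eq_map_or_insert k s
        · apply hmax
          refine ⟨t, isIncr_map.1 hs, ?_, by simp⟩
          simpa [succAbove_lt_iff, hik] using hsi
        · have := hsi k (by simp)
          omega
    · rw [count_drop_bump (by omega) (by omega)]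
      have h1 := ih σ (i := i - 1) (by omega)
      have h2 := ih σ (i := k) (by omega)
      rw [show n - (i - 1) = n + 1 - i by omega] at h1
      constructor
      · rcases max_choice (((lisWord σ).drop (n + 1 - i)).count true)
          (((lisWord σ).drop (n - k)).count true + 1) with h | h <;> rw [h]
        · obtain ⟨s, hs, hsi, hc⟩ := h1.1
          refine ⟨s.map k.succAboveEmb, isIncr_map.2 hs, ?_, by simpa using hc⟩
          simpa [succAbove_lt_iff, hik] using hsi
        · obtain ⟨s, hs, hsi, hc⟩ := h2.1
          refine ⟨insert k (s.map k.succAboveEmb), isIncr_insert_map.2 ⟨hs, hsi⟩, ?_, ?_⟩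
          · simp only [Finset.forall_mem_insert, Finset.mem_map, Fin.succAboveEmb_apply]
            refine ⟨by omega, ?_⟩
            rintro _ ⟨x, hx, rfl⟩
            rw [succAbove_lt_iff, if_neg hik]
            have := hsi x hx
            omega
          · rw [Finset.card_insert_of_notMem (by simp [Fin.succAbove_ne]), Finset.card_map, hc]
      · rintro c ⟨s, hs, hsi, rfl⟩
        obtain ⟨t, rfl | rfl⟩ := exists_eq_map_or_insert k s
        · refine le_max_of_le_left (h1.2 ⟨t, isIncr_map.1 hs, ?_, by simp⟩)
          simpa [succAbove_lt_iff, hik] using hsi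
        · obtain ⟨ht, htk⟩ := isIncr_insert_map.1 hs
          rw [Finset.card_insert_of_notMem (by simp [Fin.succAbove_ne]), Finset.card_map]
          exact le_max_of_le_right (Nat.succ_le_succ (h2.2 ⟨t, ht, htk, rfl⟩))

theorem lis_eq_count (π : Equiv.Perm (Fin n)) : lis π = (lisWord π).count true := by
  have h := isGreatest_count_drop π le_rfl
  rw [Nat.sub_self, List.drop_zero] at h
  rw [← h.csSup_eq, lis]
  congr 1
  ext c
  simp [IsIncr]

/-- `d` is a descent of `π`, in 1-based positions. -/
def IsDesc (π : Equiv.Perm (Fin n)) (d : ℕ) : Prop :=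
  1 ≤ d ∧ ∃ h : d < n, π ⟨d, h⟩ < π ⟨d - 1, by omega⟩

theorem ldes_eq {π : Equiv.Perm (Fin n)} {d : ℕ} (h : d = 0 ∨ IsDesc π d)
    (h' : ∀ c, IsDesc π c → c ≤ d) : ldes π = d := by
  have hbdd : BddAbove {d | IsDesc π d} := ⟨d, h'⟩
  change sSup {d | IsDesc π d} = d
  refine le_antisymm (csSup_le' h') ?_
  rcases h with rfl | h
  · simp
  · exact le_csSup hbdd h

theorem isDesc_le_ldes {π : Equiv.Perm (Fin n)} {d : ℕ} (h : IsDesc π d) : d ≤ ldes π :=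
  le_csSup (s := {d | IsDesc π d}) ⟨n, fun _ h => h.2.1.le⟩ h

theorem ldes_eq_zero_or_isDesc (π : Equiv.Perm (Fin n)) : ldes π = 0 ∨ IsDesc π (ldes π) := by
  rcases Set.eq_empty_or_nonempty {d | IsDesc π d} with h | h
  · left
    change sSup {d | IsDesc π d} = 0
    simp [h]
  · exact Or.inr (Nat.sSup_mem h ⟨n, fun _ h => h.2.1.le⟩)

theorem ldes_le_iff {π : Equiv.Perm (Fin n)} {k : ℕ} :
    ldes π ≤ k ↔ ∀ i j : Fin n, k ≤ i → i < j → π i < π j := by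
  constructor
  · intro h
    have key : ∀ m (i : Fin n) (hm : i + (m + 1) < n), k ≤ i → π i < π ⟨i + (m + 1), hm⟩ := by
      intro m
      induction m with
      | zero =>
        intro i hm hi
        by_contra hlt
        have hne : π i ≠ π ⟨i + (0 + 1), hm⟩ := by
          intro h'
          have := congrArg Fin.val (π.injective h')
          simp at this
        have : IsDesc π (i + 1) := ⟨by omega, hm, lt_of_le_of_ne (not_lt.1 hlt) hne.symm⟩
        have := isDesc_le_ldes this
        omega
      | succ m ih =>
        intro i hm hi
        have h1 := ih ⟨i + 1, by omega⟩ (by simp; omega) (by simp; omega)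
        by_contra hlt
        have hne : π i ≠ π ⟨i + 1, by omega⟩ := by
          intro h'
          have := congrArg Fin.val (π.injective h')
          simp at this
        have h2 : π ⟨i + 1, by omega⟩ < π i := by
          refine lt_of_lt_of_le h1 ?_
          convert not_lt.1 hlt using 3
          simp
          omega
        have : IsDesc π (i + 1) := ⟨by omega, by omega, h2⟩
        have := isDesc_le_ldes this
        omega
    intro i j hi hij
    rw [Fin.lt_def] at hij
    convert key (j - i - 1) i (by omega) hi using 2
    ext
    simp
    omega
  · intro h
    rcases ldes_eq_zero_or_isDesc π with h0 | ⟨h1, h2, h3⟩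
    · omega
    · by_contra hk
      exact lt_asymm h3 (h _ _ (by simp; omega) (by rw [Fin.lt_def]; simp; omega))

theorem avoids321_insertMax {k : Fin (n + 1)} {σ : Equiv.Perm (Fin n)} :
    Avoids321 (insertMax k σ) ↔ Avoids321 σ ∧ ldes σ ≤ k := by
  rw [ldes_le_iff]
  constructor
  · intro h
    constructor
    · rintro ⟨a, b, c, h1, h2, h3, h4⟩
      exact h ⟨k.succAbove a, k.succAbove b, k.succAbove c, by simpa, by simpa, by simpa,
        by simpa⟩
    · intro i j hi hij
      by_contra hlt
      refine h ⟨k, k.succAbove i, k.succAbove j, ?_, by simpa, ?_, by simp⟩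
      · rw [Fin.lt_succAbove_iff_le_castSucc, Fin.le_def]
        simpa using hi
      · have : σ j ≠ σ i := fun h' => hij.ne' (σ.injective h')
        simpa using lt_of_le_of_ne (not_lt.1 hlt) this
  · rintro ⟨h1, h2⟩ ⟨a, b, c, hab, hbc, h3, h4⟩
    have hb : b ≠ k := by
      rintro rfl
      rw [insertMax_self] at h4
      exact absurd h4 (Fin.le_last _).not_gt
    have hc : c ≠ k := by
      rintro rfl
      rw [insertMax_self] at h3
      exact absurd h3 (Fin.le_last _).not_gt
    obtain ⟨b, rfl⟩ := Fin.exists_succAbove_eq hb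
    obtain ⟨c, rfl⟩ := Fin.exists_succAbove_eq hc
    by_cases ha : a = k
    · subst ha
      rw [Fin.lt_succAbove_iff_le_castSucc, Fin.le_def] at hab
      exact lt_asymm (h2 b c (by simpa using hab) (by simpa using hbc)) (by simpa using h3)
    · obtain ⟨a, rfl⟩ := Fin.exists_succAbove_eq ha
      exact h1 ⟨a, b, c, by simpa using hab, by simpa using hbc, by simpa using h3,
        by simpa using h4⟩

theorem ldes_insertMax {k : Fin (n + 1)} {σ : Equiv.Perm (Fin n)} (h : ldes σ ≤ k) :
    ldes (insertMax k σ) = if (k : ℕ) = n then ldes σ else k + 1 := by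
  have hkn : (k : ℕ) ≤ n := Nat.lt_succ_iff.1 k.2
  split_ifs with hk
  · obtain rfl : k = Fin.last n := Fin.ext hk
    have hval (i : Fin n) : insertMax (Fin.last n) σ i.castSucc = (σ i).castSucc := by
      rw [← Fin.succAbove_last_apply, insertMax_succAbove]
    have hdesc (d : ℕ) : IsDesc (insertMax (Fin.last n) σ) d ↔ IsDesc σ d := by
      refine and_congr_right fun hd => ?_
      constructor
      · rintro ⟨h1, h2⟩
        rcases Nat.lt_succ_iff_lt_or_eq.1 h1 with h3 | rfl
        · refine ⟨h3, ?_⟩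
          have e1 := hval ⟨d, h3⟩
          have e2 := hval ⟨d - 1, by omega⟩
          simp only [Fin.castSucc_mk] at e1 e2
          rw [e1, e2] at h2
          simpa using h2
        · have : (⟨d, h1⟩ : Fin (d + 1)) = Fin.last d := rfl
          rw [this, insertMax_self] at h2
          exact absurd h2 (Fin.le_last _).not_gt
      · rintro ⟨h1, h2⟩
        refine ⟨by omega, ?_⟩
        have e1 := hval ⟨d, h1⟩
        have e2 := hval ⟨d - 1, by omega⟩
        simp only [Fin.castSucc_mk] at e1 e2
        rw [e1, e2]
        simpa using h2
    refine ldes_eq ?_ fun c hc => isDesc_le_ldes ((hdesc c).1 hc)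
    rw [hdesc]
    exact ldes_eq_zero_or_isDesc σ
  · have hlt : ∀ i j : Fin (n + 1), k < i → i < j → insertMax k σ i < insertMax k σ j := by
      intro i j hi hij
      obtain ⟨i, rfl⟩ := Fin.exists_succAbove_eq hi.ne'
      obtain ⟨j, rfl⟩ := Fin.exists_succAbove_eq (hi.trans hij).ne'
      rw [Fin.lt_succAbove_iff_le_castSucc, Fin.le_def] at hi
      simpa using ldes_le_iff.1 h i j (by simpa using hi) (by simpa using hij)
    refine ldes_eq (Or.inr ⟨by omega, by omega, ?_⟩) fun c hc => ?_
    · have e : (⟨(k : ℕ) + 1 - 1, by omega⟩ : Fin (n + 1)) = k := Fin.ext (by simp)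
      rw [e, insertMax_self]
      refine lt_of_le_of_ne (Fin.le_last _) fun h' => ?_
      rw [← insertMax_self k σ] at h'
      have := congrArg Fin.val ((insertMax k σ).injective h')
      simp at this
    · obtain ⟨h1, h2, h3⟩ := hc
      by_contra hck
      exact lt_asymm h3 (hlt _ _ (by rw [Fin.lt_def]; simp; omega)
        (by rw [Fin.lt_def]; simp; omega))

theorem ldes_eq_sub_tailRun {π : Equiv.Perm (Fin n)} (h : Avoids321 π) :
    ldes π = n - tailRun (lisWord π) := by
  induction n with
  | zero =>
    refine ldes_eq (Or.inl (by simp)) ?_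
    rintro c ⟨h1, h2, -⟩
    omega
  | succ n ih =>
    obtain ⟨k, σ, rfl⟩ := exists_insertMax π
    obtain ⟨h1, h2⟩ := avoids321_insertMax.1 h
    have h3 := ih h1
    have h4 := tailRun_le_length (lisWord σ)
    have hkn : (k : ℕ) ≤ n := Nat.lt_succ_iff.1 k.2
    rw [length_lisWord] at h4
    rw [ldes_insertMax h2, lisWord_insertMax]
    split_ifs with hk
    · rw [hk, Nat.sub_self, h3]
      cases hw : lisWord σ <;> simp [bump, tailRun]
    · rw [tailRun_bump (by omega) (by omega)]
      omega

theorem avoids321_insertMax_iff_le_tailRun {k : Fin (n + 1)} {σ : Equiv.Perm (Fin n)} :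
    Avoids321 (insertMax k σ) ↔ Avoids321 σ ∧ n - k ≤ tailRun (lisWord σ) := by
  rw [avoids321_insertMax]
  refine and_congr_right fun h => ?_
  rw [ldes_eq_sub_tailRun h]
  omega

theorem ballot_lisWord {π : Equiv.Perm (Fin n)} (h : Avoids321 π) : Ballot (lisWord π) := by
  induction n with
  | zero => simp [lisWord, Ballot]
  | succ n ih =>
    obtain ⟨k, σ, rfl⟩ := exists_insertMax π
    obtain ⟨h1, h2⟩ := avoids321_insertMax_iff_le_tailRun.1 h
    rw [lisWord_insertMax]
    exact (ih h1).bump h2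

end Word

/-- The sum of the signs of the ballot words with `a` letters `true` and `b` letters `false`. -/
def signCount {R : Type*} [CommRing R] (e : R) : ℕ → ℕ → R
  | _, 0 => 1
  | 0, _ + 1 => 0
  | a + 1, b + 1 => if a < b then 0 else e ^ (b + 1) * signCount e a (b + 1) + signCount e (a + 1) b

section Count

variable {R : Type*} [CommRing R]

theorem signCount_eq_zero (e : R) {a b : ℕ} (h : a < b) : signCount e a b = 0 := by
  cases b with
  | zero => omega
  | succ b =>
    cases a with
    | zero => simp [signCount]
    | succ a => simp [signCount, Nat.succ_lt_succ_iff.1 h]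

@[simp]
theorem signCount_zero_right (e : R) (a : ℕ) : signCount e a 0 = 1 := by
  cases a <;> simp [signCount]

theorem signCount_succ_succ (e : R) {a b : ℕ} (h : b ≤ a) :
    signCount e (a + 1) (b + 1) =
      e ^ (b + 1) * signCount e a (b + 1) + signCount e (a + 1) b := by
  simp [signCount, h.not_gt]

/-- The sum over the results `w'` of the insertions of an up step into `w`. -/
theorem sum_bump (e : R) {n : ℕ} {w : List Bool} (hw : w.length = n) (w' : List Bool) :
    ∑ m ∈ Finset.range (n + 1), (if m ≤ tailRun w ∧ bump m w = w' then e ^ m else 0) =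
      (if w' = true :: w then 1 else 0) +
      (if HasPeak w' ∧ w = unbump w' then e ^ tailRun w' else 0) +
      if ∃ u, w' = false :: u ∧ true ∈ u ∧ w = removeUp w' then e ^ tailRun w' else 0 := by
  rw [Finset.sum_range_succ']
  have h0 : (if 0 ≤ tailRun w ∧ bump 0 w = w' then e ^ 0 else 0) =
      if w' = true :: w then (1 : R) else 0 := by
    cases w <;> simp [bump, eq_comm]
  rw [h0, add_comm, add_assoc]
  congr 1
  have hexcl : ¬ ((HasPeak w' ∧ w = unbump w') ∧
      ∃ u, w' = false :: u ∧ true ∈ u ∧ w = removeUp w') := by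
    rintro ⟨⟨-, rfl⟩, u, rfl, -, h⟩
    simp [unbump, removeUp] at h
  simp only [bump_eq_iff (Nat.add_one_pos _)]
  by_cases hor : (HasPeak w' ∧ w = unbump w') ∨
      ∃ u, w' = false :: u ∧ true ∈ u ∧ w = removeUp w'
  · have hr : ((if HasPeak w' ∧ w = unbump w' then e ^ tailRun w' else 0) +
        if ∃ u, w' = false :: u ∧ true ∈ u ∧ w = removeUp w' then e ^ tailRun w' else 0) =
        e ^ tailRun w' := by
      rcases hor with h | h
      · rw [if_pos h, if_neg fun h' => hexcl ⟨h, h'⟩, add_zero]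
      · rw [if_neg fun h' => hexcl ⟨h', h⟩, if_pos h, zero_add]
    have hpos : 0 < tailRun w' := by
      rcases hor with h | ⟨u, rfl, -⟩
      · exact h.1.exists_unbump.1
      · simp [tailRun]
    have hle := ((bump_eq_iff hpos w w').2 ⟨rfl, hor⟩).1.trans (tailRun_le_length w)
    rw [hr, Finset.sum_eq_single (tailRun w' - 1)]
    · rw [Nat.sub_add_cancel hpos, if_pos ⟨rfl, hor⟩]
    · intro m _ hm
      exact if_neg fun h => by omega
    · intro h
      simp only [Finset.mem_range] at h
      omega
  · rw [not_or] at hor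
    simp [hor]

variable {e : R} {wt : ∀ n, Equiv.Perm (Fin n) → R}

/-- The weighted number of 321-avoiding permutations with a given word. -/
noncomputable def fiberSum (wt : ∀ n, Equiv.Perm (Fin n) → R) (n : ℕ) (w : List Bool) : R :=
  ∑ π ∈ Finset.univ.filter (fun π : Equiv.Perm (Fin n) => Avoids321 π),
    if w = lisWord π then wt n π else 0

theorem fiberSum_eq_zero {n : ℕ} {w : List Bool} (h : ¬ Ballot w) : fiberSum wt n w = 0 := by
  refine Finset.sum_eq_zero fun π hπ => if_neg ?_
  rintro rfl
  exact h (ballot_lisWord (Finset.mem_filter.1 hπ).2)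

theorem fiberSum_succ
    (hwt : ∀ n k (σ : Equiv.Perm (Fin n)), wt (n + 1) (insertMax k σ) = e ^ (n - k : ℕ) * wt n σ)
    (n : ℕ) (w' : List Bool) :
    fiberSum wt (n + 1) w' =
      (if ∃ u, w' = true :: u then fiberSum wt n w'.tail else 0) +
      (if HasPeak w' then e ^ tailRun w' * fiberSum wt n (unbump w') else 0) +
      if ∃ u, w' = false :: u ∧ true ∈ u then e ^ tailRun w' * fiberSum wt n (removeUp w')
        else 0 := by
  have key : fiberSum wt (n + 1) w' =
      ∑ σ ∈ Finset.univ.filter (fun σ : Equiv.Perm (Fin n) => Avoids321 σ), wt n σ *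
        ∑ m ∈ Finset.range (n + 1),
          (if m ≤ tailRun (lisWord σ) ∧ bump m (lisWord σ) = w' then e ^ m else 0) := by
    rw [fiberSum, Finset.sum_filter, ← (insertMaxEquiv n).sum_comp, Fintype.sum_prod_type_right,
      Finset.sum_filter]
    refine Finset.sum_congr rfl fun σ _ => ?_
    rw [← Finset.sum_range_reflect, ← Fin.sum_univ_eq_sum_range
      (fun j => if n + 1 - 1 - j ≤ tailRun (lisWord σ) ∧ bump (n + 1 - 1 - j) (lisWord σ) = w'
        then e ^ (n + 1 - 1 - j) else 0)]
    split_ifs with hσ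
    · rw [Finset.mul_sum]
      refine Finset.sum_congr rfl fun k _ => ?_
      change (if Avoids321 (insertMax k σ) then
        if w' = lisWord (insertMax k σ) then wt (n + 1) (insertMax k σ) else 0 else 0) = _
      rw [avoids321_insertMax_iff_le_tailRun, lisWord_insertMax, hwt, ← ite_and]
      simp only [hσ, true_and, Nat.add_sub_cancel, eq_comm (a := w')]
      split_ifs <;> ring
    · refine Finset.sum_eq_zero fun k _ => if_neg ?_
      exact fun h => hσ (avoids321_insertMax_iff_le_tailRun.1 h).1
  rw [key]
  simp only [sum_bump e (length_lisWord _), mul_add, Finset.sum_add_distrib]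
  congr 1
  · congr 1
    · split_ifs with h
      · obtain ⟨u, rfl⟩ := h
        simp only [List.tail_cons, fiberSum, List.cons.injEq, true_and, mul_ite, mul_one, mul_zero]
        exact Finset.sum_congr rfl fun _ _ => by congr
      · refine Finset.sum_eq_zero fun σ _ => ?_
        rw [if_neg fun h' => h ⟨_, h'⟩, mul_zero]
    · split_ifs with h
      · simp [h, fiberSum, Finset.mul_sum, eq_comm (a := unbump w'), mul_comm]
      · simp [h]
  · split_ifs with h
    · obtain ⟨u, rfl, h⟩ := h
      simp [h, fiberSum, Finset.mul_sum, eq_comm (a := removeUp (false :: u)), mul_comm]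
    · refine Finset.sum_eq_zero fun σ _ => ?_
      rw [if_neg fun ⟨u, h1, h2, _⟩ => h ⟨u, h1, h2⟩, mul_zero]

theorem pow_mul_pow_self (he : e * e = 1) (m : ℕ) : e ^ m * e ^ m = 1 := by
  rw [← mul_pow, he, one_pow]

theorem not_hasPeak_of_ballot {u : List Bool} (hu : Ballot u) (h : ¬ HasPeak u) :
    u.count false = 0 := by
  induction u with
  | nil => simp
  | cons c w ih =>
    cases c
    · exact absurd (List.count_pos_iff.1 (Nat.zero_lt_of_lt hu.2)) h
    · simpa using ih hu h

theorem length_eq_count_add (w : List Bool) : w.length = w.count true + w.count false :=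
  (List.count_true_add_count_false w).symm

theorem fiberSum_eq (he : e * e = 1) (hwt0 : ∀ π, wt 0 π = 1)
    (hwt : ∀ n k (σ : Equiv.Perm (Fin n)), wt (n + 1) (insertMax k σ) = e ^ (n - k : ℕ) * wt n σ)
    {n : ℕ} {w : List Bool} (hw : Ballot w) (hn : w.length = n) :
    fiberSum wt n w = e ^ w.count false * wordSign e w *
      signCount e (w.count true) (w.count false) := by
  induction n generalizing w with
  | zero =>
    obtain rfl := List.length_eq_zero_iff.1 hn
    have hav (π : Equiv.Perm (Fin 0)) : Avoids321 π := by
      rintro ⟨i, -⟩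
      exact i.elim0
    simp [fiberSum, hav, lisWord, hwt0, wordSign, Finset.filter_true]
  | succ n ih =>
    have hpeak (hp : HasPeak w) : fiberSum wt n (unbump w) =
        e ^ (w.count false - 1) * (e ^ (tailRun w + 1) * wordSign e w) *
          signCount e (w.count true) (w.count false - 1) := by
      have h1 := count_true_unbump hp
      have h2 := count_false_unbump hp
      have h3 := wordSign_unbump he hp
      have h4 := pow_mul_pow_self he (tailRun w + 1)
      have h5 := length_eq_count_add w
      have h6 := length_eq_count_add (unbump w)
      rw [ih ((ballot_unbump hp).2 hw) (by omega), h1, ← h2, Nat.add_sub_cancel, h3]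
      linear_combination (-(e ^ (unbump w).count false * wordSign e (unbump w) *
        signCount e (w.count true) ((unbump w).count false))) * h4
    rw [fiberSum_succ hwt]
    cases w with
    | nil => simp at hn
    | cons c u =>
      cases c
      · have hu : true ∈ u := List.count_pos_iff.1 (Nat.zero_lt_of_lt hw.2)
        have hp : HasPeak (false :: u) := hu
        obtain ⟨a, ha⟩ : ∃ a, u.count true = a + 1 :=
          Nat.exists_eq_succ_of_ne_zero (Nat.ne_of_gt (Nat.zero_lt_of_lt hw.2))
        have hrem : fiberSum wt n (removeUp (false :: u)) = e ^ (u.count false + 1) *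
            wordSign e (removeUp u) * signCount e a (u.count false + 1) := by
          have h1 := count_true_removeUp hu
          have h2 := count_false_removeUp u
          by_cases hb : Ballot (removeUp (false :: u))
          · have h5 := length_eq_count_add u
            have h6 := length_eq_count_add (removeUp u)
            simp at hn
            rw [ih hb (by simp [removeUp]; omega)]
            simp [removeUp, h2, wordSign, (by omega : (removeUp u).count true = a)]
          · rw [fiberSum_eq_zero hb, signCount_eq_zero, mul_zero]
            rw [ballot_removeUp_cons hu] at hb
            by_contra hlt
            exact hb ⟨hw, by omega⟩
        have hs := wordSign_removeUp he hu
        have h4 := hw.2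
        rw [if_neg (by simp), if_pos hp, if_pos ⟨u, rfl, hu⟩, hpeak hp, hrem, zero_add]
        simp only [List.count_cons_self, Nat.add_sub_cancel, tailRun, wordSign,
          List.count_cons_of_ne (show false ≠ true by simp), ha]
        rw [signCount_succ_succ e (by omega : u.count false ≤ a), hs]
        generalize wordSign e (removeUp u) = s
        generalize signCount e a (u.count false + 1) = x
        generalize signCount e (a + 1) (u.count false) = y
        have h1 := pow_mul_pow_self he (leadFalse u)
        have h2 := pow_mul_pow_self he (u.count false)
        generalize u.count false = b at h2 ⊢
        generalize leadFalse u = l at h1 ⊢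
        simp only [pow_add, pow_one]
        generalize e ^ b = B at *
        generalize e ^ l = L at *
        linear_combination (L * e * B * B * s * y) * (e * e * h1 + he) - (L * e * e * B * s * x) * h2
      · have hu : Ballot u := hw
        have hno : ¬ ∃ v, true :: u = false :: v ∧ true ∈ v := by simp
        rw [if_pos ⟨u, rfl⟩, if_neg hno, add_zero, List.tail_cons,
          ih hu (by simpa using hn)]
        by_cases hp : HasPeak u
        · have hp' : HasPeak (true :: u) := hp
          have h2 := count_false_unbump hp
          have h3 := hu.count_le
          rw [if_pos hp', hpeak hp']
          obtain ⟨b, hb⟩ : ∃ b, u.count false = b + 1 := ⟨_, h2.symm⟩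
          simp only [List.count_cons_self, tailRun, wordSign,
            List.count_cons_of_ne (show true ≠ false by simp), hb, Nat.add_sub_cancel]
          rw [signCount_succ_succ e (by omega)]
          generalize wordSign e u = s
          generalize signCount e _ (b + 1) = x
          generalize signCount e _ b = y
          have h1 := pow_mul_pow_self he (tailRun u)
          have h2 := pow_mul_pow_self he b
          simp only [pow_add, pow_one]
          generalize e ^ b = B at *
          generalize e ^ tailRun u = L at *
          linear_combination (B ^ 2 * e ^ 2 * s * y) * (e * e * h1 + he) -
            (B * e * s * x) * (e * e * h2 + he)
        · have h0 := not_hasPeak_of_ballot hu hp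
          have hp' : ¬ HasPeak (true :: u) := hp
          simp [hp', h0, wordSign]

end Count

/-- The ballot words with `a` letters `true` and `b` letters `false`. -/
def ballotWords : ℕ → ℕ → Finset (List Bool)
  | 0, 0 => {[]}
  | 0, _ + 1 => ∅
  | a + 1, 0 => (ballotWords a 0).map ⟨List.cons true, List.cons_injective⟩
  | a + 1, b + 1 => if a < b then ∅ else
      (ballotWords a (b + 1)).map ⟨List.cons true, List.cons_injective⟩ ∪
        (ballotWords (a + 1) b).map ⟨List.cons false, List.cons_injective⟩

theorem mem_ballotWords {w : List Bool} {a b : ℕ} :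
    w ∈ ballotWords a b ↔ Ballot w ∧ w.count true = a ∧ w.count false = b := by
  induction w generalizing a b with
  | nil =>
    rcases a with _ | a <;> rcases b with _ | b <;> simp [ballotWords, Ballot]
    split_ifs <;> simp
  | cons c w ih =>
    have hle (h : Ballot w) := h.count_le
    rcases a with _ | a <;> rcases b with _ | b <;> cases c <;>
      simp [ballotWords, Ballot, ih]
    · intros
      omega
    · split_ifs
      · simp
        intros
        omega
      · simp [ih]
        intros
        omega
    · split_ifs
      · simp
        intro h
        have := hle h
        omega
      · simp [ih]

section Sums

variable {R : Type*} [CommRing R]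

theorem sum_ballotWords_succ_zero (a : ℕ) (F : List Bool → R) :
    ∑ w ∈ ballotWords (a + 1) 0, F w = ∑ w ∈ ballotWords a 0, F (true :: w) := by
  simp [ballotWords]

theorem sum_ballotWords_succ_succ {a b : ℕ} (h : b ≤ a) (F : List Bool → R) :
    ∑ w ∈ ballotWords (a + 1) (b + 1), F w =
      ∑ w ∈ ballotWords a (b + 1), F (true :: w) + ∑ w ∈ ballotWords (a + 1) b, F (false :: w) := by
  rw [ballotWords, if_neg h.not_gt, Finset.sum_union]
  · simp
  · rw [Finset.disjoint_left]
    simp only [Finset.mem_map, Function.Embedding.coeFn_mk, not_exists, not_and]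
    rintro _ ⟨x, -, rfl⟩ y - hy
    simp at hy

theorem ballotWords_eq_empty {a b : ℕ} (h : a < b) : ballotWords a b = ∅ := by
  refine Finset.eq_empty_of_forall_notMem fun w hw => ?_
  obtain ⟨h1, h2, h3⟩ := mem_ballotWords.1 hw
  have := h1.count_le
  omega

theorem sum_wordSign (e : R) (a b : ℕ) :
    ∑ w ∈ ballotWords a b, wordSign e w = signCount e a b := by
  induction b generalizing a with
  | zero =>
    induction a with
    | zero => simp [ballotWords, wordSign]
    | succ a ih =>
      rw [sum_ballotWords_succ_zero, signCount_zero_right, ← signCount_zero_right e a, ← ih]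
      refine Finset.sum_congr rfl fun w hw => ?_
      simp [wordSign, (mem_ballotWords.1 hw).2.2]
  | succ b ihb =>
    induction a with
    | zero => simp [ballotWords, signCount]
    | succ a iha =>
      rcases lt_or_ge a b with h | h
      · rw [ballotWords_eq_empty (by omega), signCount_eq_zero e (by omega), Finset.sum_empty]
      · rw [sum_ballotWords_succ_succ h, signCount_succ_succ e h, ← iha, ← ihb, Finset.mul_sum]
        congr 1
        refine Finset.sum_congr rfl fun w hw => ?_
        simp [wordSign, (mem_ballotWords.1 hw).2.2]

/-- The signed sum over ballot words `w` of `φ d`, where `d` is the last position at which an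
up step is followed by a down step. -/
def peakSum (e : R) (φ : ℕ → R) (a b : ℕ) : R :=
  ∑ w ∈ ballotWords a b, wordSign e w * φ (w.length - tailRun w)

theorem sum_leadFalse (e : R) (φ : ℕ → R) {a b : ℕ} (h : b ≤ a + 1) :
    ∑ w ∈ ballotWords (a + 1) b, wordSign e w * φ (w.length - leadFalse w) =
      ∑ i ∈ Finset.range (b + 1), e ^ i * signCount e a i * φ (a + 1 + i) := by
  induction b with
  | zero =>
    rw [sum_ballotWords_succ_zero, Finset.sum_range_one, ← sum_wordSign, Finset.mul_sum,
      Finset.sum_mul]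
    refine Finset.sum_congr rfl fun w hw => ?_
    obtain ⟨-, h1, h2⟩ := mem_ballotWords.1 hw
    simp [wordSign, leadFalse, length_eq_count_add w, h1, h2]
  | succ b ih =>
    rw [sum_ballotWords_succ_succ (by omega), Finset.sum_range_succ, ← ih (by omega), add_comm]
    congr 1
    · refine Finset.sum_congr rfl fun w _ => ?_
      simp [wordSign, leadFalse]
    · rw [← sum_wordSign, Finset.mul_sum, Finset.sum_mul]
      refine Finset.sum_congr rfl fun w hw => ?_
      obtain ⟨-, h1, h2⟩ := mem_ballotWords.1 hw
      simp [wordSign, leadFalse, length_eq_count_add w, h1, h2, add_right_comm, add_assoc]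

theorem peakSum_zero_right (e : R) (φ : ℕ → R) (a : ℕ) : peakSum e φ a 0 = φ 0 := by
  induction a with
  | zero => simp [peakSum, ballotWords, wordSign]
  | succ a ih =>
    rw [← ih, peakSum, sum_ballotWords_succ_zero, peakSum]
    refine Finset.sum_congr rfl fun w hw => ?_
    simp [wordSign, tailRun, (mem_ballotWords.1 hw).2.2]

theorem peakSum_eq_zero (e : R) (φ : ℕ → R) {a b : ℕ} (h : a < b) : peakSum e φ a b = 0 := by
  simp [peakSum, ballotWords_eq_empty h]

theorem peakSum_succ_succ (e : R) (φ : ℕ → R) {a b : ℕ} (h : b ≤ a) :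
    peakSum e φ (a + 1) (b + 1) = e ^ (b + 1) * peakSum e φ a (b + 1) +
      ∑ i ∈ Finset.range (b + 1), e ^ i * signCount e a i * φ (a + 1 + i) := by
  rw [peakSum, sum_ballotWords_succ_succ h, ← sum_leadFalse e φ (by omega), peakSum,
    Finset.mul_sum]
  congr 1 <;> refine Finset.sum_congr rfl fun w hw => ?_
  · simp [wordSign, tailRun, (mem_ballotWords.1 hw).2.2, mul_assoc]
  · simp [wordSign, tailRun]

theorem signCount_neg_one (p s : ℕ) :
    signCount (-1 : R) (2 * p + 1) (2 * s) = signCount 1 p s ∧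
    signCount (-1 : R) (2 * p + 1) (2 * s + 1) = signCount 1 p s ∧
    signCount (-1 : R) (2 * p + 2) (2 * s) = signCount 1 p s ∧
    signCount (-1 : R) (2 * p + 2) (2 * s + 1) = 0 := by
  induction p generalizing s with
  | zero =>
    rcases s with _ | _ | s
    · simp [signCount]
    · simp [signCount]
    · have h0 : signCount (1 : R) 0 (s + 1 + 1) = 0 := signCount_eq_zero _ (by omega)
      rw [h0]
      exact ⟨signCount_eq_zero _ (by omega), signCount_eq_zero _ (by omega),
        signCount_eq_zero _ (by omega), signCount_eq_zero _ (by omega)⟩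
  | succ p ihp =>
    have step (s : ℕ)
        (h : signCount (-1 : R) (2 * (p + 1) + 1) (2 * s) = signCount 1 (p + 1) s)
        (h' : signCount (-1 : R) (2 * (p + 1) + 2) (2 * s) = signCount 1 (p + 1) s) :
        signCount (-1 : R) (2 * (p + 1) + 1) (2 * s + 1) = signCount 1 (p + 1) s ∧
        signCount (-1 : R) (2 * (p + 1) + 2) (2 * s + 1) = 0 := by
      rcases lt_or_ge (p + 1) s with hs | hs
      · rw [signCount_eq_zero 1 hs]
        exact ⟨signCount_eq_zero _ (by omega), signCount_eq_zero _ (by omega)⟩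
      · have h1 : signCount (-1 : R) (2 * (p + 1) + 1) (2 * s + 1) = signCount 1 (p + 1) s := by
          rw [signCount_succ_succ _ (by omega), h, show 2 * (p + 1) = 2 * p + 2 by ring,
            (ihp s).2.2.2]
          simp
        refine ⟨h1, ?_⟩
        rw [show 2 * (p + 1) + 2 = 2 * (p + 1) + 1 + 1 by ring] at h' ⊢
        rw [signCount_succ_succ _ (by omega), h1, h']
        simp [pow_succ, pow_mul]
    induction s with
    | zero =>
      have := step 0 (by simp) (by simp)
      exact ⟨by simp, this.1, by simp, this.2⟩
    | succ s ihs =>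
      have h1 : signCount (-1 : R) (2 * (p + 1) + 1) (2 * (s + 1)) =
          signCount 1 (p + 1) (s + 1) := by
        rcases lt_or_ge p s with hs | hs
        · rw [signCount_eq_zero _ (by omega), signCount_eq_zero _ (by omega)]
        · rw [show 2 * (s + 1) = 2 * s + 1 + 1 by ring, signCount_succ_succ _ (by omega),
            ihs.2.1, show 2 * (p + 1) = 2 * p + 2 by ring,
            show 2 * s + 1 + 1 = 2 * (s + 1) by ring, (ihp (s + 1)).2.2.1,
            signCount_succ_succ _ hs]
          simp [pow_mul]
      have h2 : signCount (-1 : R) (2 * (p + 1) + 2) (2 * (s + 1)) =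
          signCount 1 (p + 1) (s + 1) := by
        rcases lt_or_ge (p + 1) s with hs | hs
        · rw [signCount_eq_zero _ (by omega), signCount_eq_zero _ (by omega)]
        · rw [show 2 * (s + 1) = 2 * s + 1 + 1 by ring,
            show 2 * (p + 1) + 2 = 2 * (p + 1) + 1 + 1 by ring,
            signCount_succ_succ _ (by omega), ihs.2.2.2,
            show 2 * s + 1 + 1 = 2 * (s + 1) by ring, h1]
          simp [pow_mul]
      have := step (s + 1) h1 h2
      exact ⟨h1, this.1, h2, this.2⟩

theorem signCount_neg_one_even_odd (p s : ℕ) :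
    signCount (-1 : R) (2 * p) (2 * s + 1) = 0 := by
  rcases p with _ | p
  · simp [signCount]
  · exact (signCount_neg_one p s).2.2.2

theorem sum_range_two_mul (f : ℕ → R) (s : ℕ) :
    ∑ i ∈ Finset.range (2 * s), f i = ∑ i ∈ Finset.range s, (f (2 * i) + f (2 * i + 1)) := by
  induction s with
  | zero => simp
  | succ s ih =>
    rw [show 2 * (s + 1) = 2 * s + 1 + 1 by ring, Finset.sum_range_succ, Finset.sum_range_succ,
      Finset.sum_range_succ, ih]
    ring

theorem peakSum_neg_one {φ ψ : ℕ → R} (hφ : ∀ d, φ (2 * d) = ψ d)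
    (hφ' : ∀ d, φ (2 * d + 1) = 0) (p s : ℕ) :
    peakSum (-1) φ (2 * p + 1) (2 * s) = peakSum 1 ψ p s := by
  rcases s with _ | s
  · have := hφ 0
    simpa [peakSum_zero_right] using this
  have hodd (p : ℕ) : ∑ i ∈ Finset.range (2 * s + 1 + 1),
      (-1) ^ i * signCount (-1) (2 * p) i * φ (2 * p + 1 + i) = 0 := by
    rw [show 2 * s + 1 + 1 = 2 * (s + 1) by ring, sum_range_two_mul]
    refine Finset.sum_eq_zero fun i _ => ?_
    rw [signCount_neg_one_even_odd, show 2 * p + 1 + 2 * i = 2 * (p + i) + 1 by ring, hφ']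
    simp
  have heven (p : ℕ) : ∑ i ∈ Finset.range (2 * s + 1 + 1),
      (-1) ^ i * signCount (-1) (2 * p + 1) i * φ (2 * p + 1 + 1 + i) =
      ∑ i ∈ Finset.range (s + 1), 1 ^ i * signCount 1 p i * ψ (p + 1 + i) := by
    rw [show 2 * s + 1 + 1 = 2 * (s + 1) by ring, sum_range_two_mul]
    refine Finset.sum_congr rfl fun i _ => ?_
    rw [(signCount_neg_one p i).1, show 2 * p + 1 + 1 + 2 * i = 2 * (p + 1 + i) by ring, hφ,
      show 2 * p + 1 + 1 + (2 * i + 1) = 2 * (p + 1 + i) + 1 by ring, hφ']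
    simp [pow_mul]
  induction p with
  | zero => rw [peakSum_eq_zero _ _ (by omega), peakSum_eq_zero _ _ (by omega)]
  | succ p ih =>
    rcases lt_or_ge p s with hs | hs
    · rw [peakSum_eq_zero _ _ (by omega), peakSum_eq_zero _ _ (by omega)]
    · rw [show 2 * (s + 1) = 2 * s + 1 + 1 by ring] at ih ⊢
      rw [peakSum_succ_succ _ _ (by omega), hodd, show 2 * (p + 1) = 2 * p + 1 + 1 by ring,
        peakSum_succ_succ _ _ (by omega), ih, heven, peakSum_succ_succ _ _ hs,
        show 2 * s + 1 + 1 = 2 * (s + 1) by ring]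
      simp [pow_mul]

theorem sum_lis_eq {e : R} {wt : ∀ n, Equiv.Perm (Fin n) → R} (he : e * e = 1)
    (hwt0 : ∀ π, wt 0 π = 1)
    (hwt : ∀ n k (σ : Equiv.Perm (Fin n)), wt (n + 1) (insertMax k σ) = e ^ (n - k : ℕ) * wt n σ)
    (φ : ℕ → R) {n a b : ℕ} (hab : a + b = n) :
    ∑ π ∈ Finset.univ.filter (fun π : Equiv.Perm (Fin n) => Avoids321 π ∧ lis π = a),
      wt n π * φ (ldes π) = e ^ b * signCount e a b * peakSum e φ a b := by
  have hmaps : ∀ π ∈ Finset.univ.filter (fun π : Equiv.Perm (Fin n) => Avoids321 π ∧ lis π = a),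
      lisWord π ∈ ballotWords a b := by
    intro π hπ
    obtain ⟨h1, h2⟩ := (Finset.mem_filter.1 hπ).2
    have h3 := length_eq_count_add (lisWord π)
    rw [length_lisWord] at h3
    rw [lis_eq_count] at h2
    exact mem_ballotWords.2 ⟨ballot_lisWord h1, h2, by omega⟩
  rw [← Finset.sum_fiberwise_of_maps_to hmaps, peakSum, Finset.mul_sum]
  refine Finset.sum_congr rfl fun w hw => ?_
  obtain ⟨h1, h2, h3⟩ := mem_ballotWords.1 hw
  have hlen : w.length = n := by rw [length_eq_count_add]; omega
  have h4 := fiberSum_eq he hwt0 hwt h1 hlen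
  rw [h2, h3] at h4
  calc _ = fiberSum wt n w * φ (n - tailRun w) := by
        rw [fiberSum, ← Finset.sum_filter, Finset.sum_mul, Finset.filter_filter,
          Finset.filter_filter]
        refine Finset.sum_congr ?_ fun π hπ => ?_
        · ext π
          simp only [Finset.mem_filter, Finset.mem_univ, true_and]
          constructor
          · rintro ⟨⟨h, -⟩, rfl⟩
            exact ⟨h, rfl⟩
          · rintro ⟨h, rfl⟩
            exact ⟨⟨h, by rw [lis_eq_count, h2]⟩, rfl⟩
        · obtain ⟨h5, rfl⟩ := (Finset.mem_filter.1 hπ).2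
          rw [ldes_eq_sub_tailRun h5]
    _ = _ := by
        rw [h4, hlen]
        ring

end Sums

theorem lis_le {n : ℕ} (π : Equiv.Perm (Fin n)) : lis π ≤ n := by
  rw [lis_eq_count]
  exact List.count_le_length.trans_eq (length_lisWord π)

theorem refined_sign_balance_odd (n : ℕ) (hn : 1 ≤ n) :
    ∑ π ∈ Finset.univ.filter (fun π : Equiv.Perm (Fin n) => Avoids321 π),
        (X 0 : MvPolynomial (Fin 2) ℤ) ^ (2 * lis π + 1) * X 1 ^ (2 * ldes π)
      =
    ∑ π ∈ Finset.univ.filter (fun π : Equiv.Perm (Fin (2 * n + 1)) =>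
          Avoids321 π ∧ Even (ldes π) ∧ Odd (lis π)),
        C ((Equiv.Perm.sign π : ℤ)) * X 0 ^ lis π * X 1 ^ ldes π := by
  set ψ : ℕ → MvPolynomial (Fin 2) ℤ := fun d => X 1 ^ (2 * d) with hψ
  set φ : ℕ → MvPolynomial (Fin 2) ℤ := fun d => if Even d then X 1 ^ d else 0 with hφ
  have hl : ∀ π ∈ Finset.univ.filter (fun π : Equiv.Perm (Fin n) => Avoids321 π),
      lis π ∈ Finset.range (n + 1) := fun π _ => Finset.mem_range.2 (Nat.lt_succ_of_le (lis_le π))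
  have hr : ∀ π ∈ Finset.univ.filter (fun π : Equiv.Perm (Fin (2 * n + 1)) =>
      Avoids321 π ∧ Even (ldes π) ∧ Odd (lis π)), lis π / 2 ∈ Finset.range (n + 1) := by
    intro π _
    have := lis_le π
    rw [Finset.mem_range]
    omega
  rw [← Finset.sum_fiberwise_of_maps_to hl, ← Finset.sum_fiberwise_of_maps_to hr]
  refine Finset.sum_congr rfl fun a ha => ?_
  obtain ⟨b, rfl⟩ := Nat.exists_eq_add_of_le (Nat.lt_succ_iff.1 (Finset.mem_range.1 ha))
  have key1 := sum_lis_eq (e := 1) (wt := fun _ _ => 1) (one_mul 1) (fun _ => rfl)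
    (fun _ _ _ => by simp) ψ (rfl : a + b = a + b)
  have key2 := sum_lis_eq (e := -1)
    (wt := fun _ π => (C ((Equiv.Perm.sign π : ℤ)) : MvPolynomial (Fin 2) ℤ))
    (by simp) (fun π => by simp [Subsingleton.elim π 1])
    (fun _ _ _ => by simp [sign_insertMax]) φ (by ring : 2 * a + 1 + 2 * b = 2 * (a + b) + 1)
  rw [(signCount_neg_one a b).1, peakSum_neg_one (ψ := ψ) (by simp [hφ, hψ])
    (fun d => if_neg (by simp))] at key2
  simp only [pow_mul, neg_one_sq] at key2
  rw [← key1] at key2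
  trans X 0 ^ (2 * a + 1) * ∑ π ∈ Finset.univ.filter
    (fun π : Equiv.Perm (Fin (a + b)) => Avoids321 π ∧ lis π = a), 1 * ψ (ldes π)
  · rw [Finset.filter_filter, Finset.mul_sum]
    refine Finset.sum_congr rfl fun π hπ => ?_
    rw [(Finset.mem_filter.1 hπ).2.2, one_mul]
  · rw [← key2, Finset.filter_filter, Finset.mul_sum]
    have hset : Finset.univ.filter (fun π : Equiv.Perm (Fin (2 * (a + b) + 1)) =>
        (Avoids321 π ∧ Even (ldes π) ∧ Odd (lis π)) ∧ lis π / 2 = a) =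
        (Finset.univ.filter (fun π : Equiv.Perm (Fin (2 * (a + b) + 1)) =>
          Avoids321 π ∧ lis π = 2 * a + 1)).filter fun π => Even (ldes π) := by
      ext π
      simp only [Finset.mem_filter, Finset.mem_univ, true_and]
      constructor
      · rintro ⟨⟨h1, h2, c, h3⟩, h4⟩
        exact ⟨⟨h1, by omega⟩, h2⟩
      · rintro ⟨⟨h1, h2⟩, h3⟩
        exact ⟨⟨h1, h3, a, h2⟩, by omega⟩
    rw [hset]
    symm
    rw [Finset.sum_filter]
    refine Finset.sum_congr rfl fun π hπ => ?_
    rw [(Finset.mem_filter.1 hπ).2.2]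
    simp only [hφ]
    split_ifs <;> ring
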